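/- arXiv:2105.04040 — 3 statements merged into one kernel-verified Lean document; each statement's English description precedes it below -/
import Mathlib

section
/- Fix a real p ≥ 1 and let x : ℤ → ℝ have both polyphase components in ℓp(ℤ). For every integer m, the polyphase components of the odd shift T_{2m+1} x satisfy ‖poly₀(T_{2m+1} x)‖_p = ‖poly₁(x)‖_p and ‖poly₁(T_{2m+1} x)‖_p = ‖poly₀(x)‖_p. Consequently, if ‖poly₀(x)‖_p ≠ ‖poly₁(x)‖_p, then the APS index of T_{2m+1} x equals 1 minus the APS index of x. -/
noncomputable section

/-- Shift operator: `(T k x) n = x (n - k)`. -/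
def T (k : ℤ) (x : ℤ → ℝ) : ℤ → ℝ := fun n => x (n - k)

/-- Stride-2 downsampling. -/
def D2 (x : ℤ → ℝ) : ℤ → ℝ := fun n => x (2 * n)

/-- Stride-2 upsampling. -/
def U2 (y : ℤ → ℝ) : ℤ → ℝ := fun n => if (2 : ℤ) ∣ n then y (n / 2) else 0

/-- Even polyphase component. -/
def poly0 (x : ℤ → ℝ) : ℤ → ℝ := fun n => x (2 * n)

/-- Odd polyphase component. -/
def poly1 (x : ℤ → ℝ) : ℤ → ℝ := fun n => x (2 * n + 1)

/-- Membership in ℓp(ℤ): summability of |f|^p. -/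
def Memlp (p : ℝ) (f : ℤ → ℝ) : Prop := Summable (fun n => |f n| ^ p)

/-- The ℓp norm of a signal. -/
def lpNorm (p : ℝ) (f : ℤ → ℝ) : ℝ := (∑' n, |f n| ^ p) ^ (1 / p)

/-- APS index: the index of the polyphase component with larger ℓp norm. -/
def apsIndex (p : ℝ) (x : ℤ → ℝ) : ℤ :=
  if lpNorm p (poly0 x) < lpNorm p (poly1 x) then 1 else 0

/-- Adaptive polyphase downsampling: the polyphase component with larger ℓp norm. -/
def apsD (p : ℝ) (x : ℤ → ℝ) : ℤ → ℝ :=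
  if lpNorm p (poly0 x) < lpNorm p (poly1 x) then poly1 x else poly0 x

/-- Adaptive polyphase upsampling with grid index `i`. -/
def apsU (i : ℤ) (y : ℤ → ℝ) : ℤ → ℝ := T i (U2 y)

theorem lpNorm_T (p : ℝ) (k : ℤ) (f : ℤ → ℝ) : lpNorm p (T k f) = lpNorm p f :=
  congrArg (· ^ (1 / p)) ((Equiv.subRight k).tsum_eq fun n => |f n| ^ p)

theorem poly0_T_odd (m : ℤ) (x : ℤ → ℝ) : poly0 (T (2 * m + 1) x) = T (m + 1) (poly1 x) := by
  funext n
  simp only [poly0, poly1, T]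
  congr 1
  ring

theorem poly1_T_odd (m : ℤ) (x : ℤ → ℝ) : poly1 (T (2 * m + 1) x) = T m (poly0 x) := by
  funext n
  simp only [poly0, poly1, T]
  congr 1
  ring

theorem odd_shift_swaps_polyphase_norms (p : ℝ) (hp : 1 ≤ p) (x : ℤ → ℝ)
    (h0 : Memlp p (poly0 x)) (h1 : Memlp p (poly1 x)) (m : ℤ) :
    lpNorm p (poly0 (T (2 * m + 1) x)) = lpNorm p (poly1 x) ∧
    lpNorm p (poly1 (T (2 * m + 1) x)) = lpNorm p (poly0 x) ∧
    (lpNorm p (poly0 x) ≠ lpNorm p (poly1 x) →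
      apsIndex p (T (2 * m + 1) x) = 1 - apsIndex p x) := by
  have e0 : lpNorm p (poly0 (T (2 * m + 1) x)) = lpNorm p (poly1 x) := by
    rw [poly0_T_odd, lpNorm_T]
  have e1 : lpNorm p (poly1 (T (2 * m + 1) x)) = lpNorm p (poly0 x) := by
    rw [poly1_T_odd, lpNorm_T]
  refine ⟨e0, e1, fun hne => ?_⟩
  unfold apsIndex
  rw [e0, e1]
  rcases lt_or_gt_of_ne hne with h | h
  · simp [h, h.not_gt]
  · simp [h, h.not_gt]
end
end

section
/- Shift relation for APS downsampling (Eq. (4)): fix a real p ≥ 1 and let x : ℤ → ℝ have both polyphase components in ℓp(ℤ) with ‖poly₀(x)‖_p ≠ ‖poly₁(x)‖_p, and let i = i_x be its APS index. Then for every even integer k = 2m, D^A₂(T_k x) = T_{k/2}(D^A₂ x), and for every odd integer k, D^A₂(T_k x) = T_{(k + 2i − 1)/2}(D^A₂ x). -/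
noncomputable section

theorem poly0_T_even (m : ℤ) (x : ℤ → ℝ) : poly0 (T (2 * m) x) = T m (poly0 x) := by
  funext n
  simp only [poly0, T]
  congr 1
  ring

theorem poly1_T_even (m : ℤ) (x : ℤ → ℝ) : poly1 (T (2 * m) x) = T m (poly1 x) := by
  funext n
  simp only [poly1, T]
  congr 1
  ring

theorem apsD_shift_relation (p : ℝ) (hp : 1 ≤ p) (x : ℤ → ℝ)
    (h0 : Memlp p (poly0 x)) (h1 : Memlp p (poly1 x))
    (hne : lpNorm p (poly0 x) ≠ lpNorm p (poly1 x)) :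
    (∀ k : ℤ, Even k → apsD p (T k x) = T (k / 2) (apsD p x)) ∧
    (∀ k : ℤ, Odd k →
      apsD p (T k x) = T ((k + 2 * apsIndex p x - 1) / 2) (apsD p x)) := by
  constructor
  · intro k hk
    obtain ⟨m, rfl⟩ := hk.two_dvd
    have hm : 2 * m / 2 = m := by omega
    simp only [apsD, poly0_T_even, poly1_T_even, lpNorm_T, hm]
    split_ifs <;> rfl
  · rintro k ⟨m, rfl⟩
    simp only [apsD, apsIndex, poly0_T_odd, poly1_T_odd, lpNorm_T]
    rcases hne.lt_or_gt with h | h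
    · have hm : (2 * m + 1 + 2 * 1 - 1) / 2 = m + 1 := by omega
      simp only [if_pos h, if_neg h.not_gt, hm]
    · have hm : (2 * m + 1 + 2 * 0 - 1) / 2 = m := by omega
      simp only [if_pos h, if_neg h.not_gt, hm]
end
end

section
/- APS downsampling followed by conventional (non-adaptive) upsampling is not shift equivariant: fix p ≥ 1. There exist a signal x : ℤ → ℝ with both polyphase components in ℓp(ℤ) and ‖poly₀(x)‖_p ≠ ‖poly₁(x)‖_p, and an integer k such that T_k x also has distinct polyphase ℓp norms, and U₂(D^A₂(T_k x)) ≠ T_k(U₂(D^A₂ x)). -/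
noncomputable section

lemma poly0_single_zero : poly0 (Pi.single 0 1) = Pi.single 0 1 := by
  funext n
  simp [poly0, Pi.single_apply]

lemma poly1_single_zero : poly1 (Pi.single 0 1) = 0 := by
  funext n
  have : 2 * n + 1 ≠ 0 := by omega
  simp [poly1, this]

lemma T_single (k m : ℤ) : T k (Pi.single m 1) = Pi.single (m + k) 1 := by
  funext n
  simp [T, Pi.single_apply, sub_eq_iff_eq_add]

lemma poly0_single_one : poly0 (Pi.single 1 1) = 0 := by
  funext n
  have : 2 * n ≠ 1 := by omega
  simp [poly0, this]

lemma poly1_single_one : poly1 (Pi.single 1 1) = Pi.single 0 1 := by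
  funext n
  simp [poly1, Pi.single_apply]

lemma U2_single_zero : U2 (Pi.single 0 1) = Pi.single 0 1 := by
  funext n
  by_cases h : (2 : ℤ) ∣ n
  · have : n / 2 = 0 ↔ n = 0 := by omega
    simp [U2, Pi.single_apply, h, this]
  · have : n ≠ 0 := by omega
    simp [U2, h, this]

lemma memlp_of_finite_support {p : ℝ} (hp : p ≠ 0) {f : ℤ → ℝ}
    (hf : f.support.Finite) : Memlp p f := by
  refine summable_of_hasFiniteSupport (hf.subset fun n hn h => hn ?_)
  simp [h, Real.zero_rpow hp]

lemma lpNorm_zero {p : ℝ} (hp : p ≠ 0) : lpNorm p 0 = 0 := by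
  simp [lpNorm, Real.zero_rpow hp, hp]

lemma lpNorm_single {p : ℝ} (hp : p ≠ 0) (m : ℤ) : lpNorm p (Pi.single m 1) = 1 := by
  have h : ∑' n, |(Pi.single m 1 : ℤ → ℝ) n| ^ p = 1 := by
    rw [tsum_eq_single m fun n hn => by simp [hn, Real.zero_rpow hp]]
    simp
  rw [lpNorm, h, Real.one_rpow]

theorem apsD_then_U2_not_shift_equivariant (p : ℝ) (hp : 1 ≤ p) :
    ∃ (x : ℤ → ℝ) (k : ℤ),
      Memlp p (poly0 x) ∧ Memlp p (poly1 x) ∧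
      lpNorm p (poly0 x) ≠ lpNorm p (poly1 x) ∧
      lpNorm p (poly0 (T k x)) ≠ lpNorm p (poly1 (T k x)) ∧
      U2 (apsD p (T k x)) ≠ T k (U2 (apsD p x)) := by
  have hp0 : p ≠ 0 := by linarith
  refine ⟨Pi.single 0 1, 1, ?_, ?_, ?_, ?_, ?_⟩
  · rw [poly0_single_zero]
    exact memlp_of_finite_support hp0 ((Set.finite_singleton 0).subset Pi.support_single_subset)
  · rw [poly1_single_zero]
    exact memlp_of_finite_support hp0 (by simp)
  · simp [poly0_single_zero, poly1_single_zero, lpNorm_zero hp0, lpNorm_single hp0]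
  · simp [T_single, poly0_single_one, poly1_single_one, lpNorm_zero hp0, lpNorm_single hp0]
  · have h0 : apsD p (Pi.single 0 1) = Pi.single 0 1 := by
      simp [apsD, poly0_single_zero, poly1_single_zero, lpNorm_zero hp0, lpNorm_single hp0]
    have h1 : apsD p (Pi.single 1 1) = Pi.single 0 1 := by
      simp [apsD, poly0_single_one, poly1_single_one, lpNorm_zero hp0, lpNorm_single hp0]
    rw [T_single, zero_add, h0, h1, U2_single_zero, T_single, zero_add]
    intro h
    simpa using congrFun h 0
end
end
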